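/- For every integer m ≥ 2 and every q with 0 < q < 1, the inequality exp^{m-1}((log^{m-2} t)^q) ≤ log^{m-2}((exp^{m-1} t)^q) holds for all sufficiently large t. -/

import Mathlib

open Set Filter

theorem le_iterate_log_of_iterate_exp_le {k : ℕ} {x y : ℝ} (h : Real.exp^[k] x ≤ y) :
    x ≤ Real.log^[k] y := by
  induction k generalizing y with
  | zero => simpa using h
  | succ k ih =>
    rw [Function.iterate_succ_apply'] at h
    rw [Function.iterate_succ_apply]
    exact ih ((Real.le_log_iff_exp_le ((Real.exp_pos _).trans_le h)).2 h)

theorem tendsto_iterate_exp_atTop (k : ℕ) : Tendsto Real.exp^[k] atTop atTop :=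
  Real.tendsto_exp_atTop.iterate k

theorem tendsto_iterate_log_atTop (k : ℕ) : Tendsto Real.log^[k] atTop atTop :=
  Real.tendsto_log_atTop.iterate k

theorem eventually_iterate_exp_iterate_log (k : ℕ) :
    ∀ᶠ t : ℝ in atTop, Real.exp^[k] (Real.log^[k] t) = t := by
  induction k with
  | zero => simp
  | succ k ih =>
    filter_upwards [ih, (tendsto_iterate_log_atTop k).eventually_gt_atTop 0] with t ht hpos
    rw [Function.iterate_succ_apply, Function.iterate_succ_apply', Real.exp_log hpos, ht]

theorem eventually_iterate_exp_rpow_le {q : ℝ} (hq0 : 0 < q) (hq1 : q < 1) (k : ℕ) :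
    ∀ᶠ s : ℝ in atTop, Real.exp^[k] (s ^ q) ≤ q * Real.exp^[k] s := by
  have hq : 0 < 1 - q := sub_pos.2 hq1
  induction k with
  | zero =>
    filter_upwards [eventually_gt_atTop 0,
      (tendsto_rpow_atTop hq).eventually_ge_atTop q⁻¹] with s hs h
    calc s ^ q = q * (q⁻¹ * s ^ q) := by field_simp
      _ ≤ q * (s ^ (1 - q) * s ^ q) := by gcongr
      _ = q * s := by rw [← Real.rpow_add hs, sub_add_cancel, Real.rpow_one]
  | succ k ih =>
    have hexp := Real.tendsto_exp_atTop.comp ((tendsto_iterate_exp_atTop k).const_mul_atTop hq)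
    filter_upwards [ih, hexp.eventually_ge_atTop q⁻¹] with s hs h
    rw [Function.iterate_succ_apply', Function.iterate_succ_apply']
    set y := Real.exp^[k] s
    calc Real.exp (Real.exp^[k] (s ^ q)) ≤ Real.exp (q * y) := Real.exp_le_exp.2 hs
      _ = q * (q⁻¹ * Real.exp (q * y)) := by field_simp
      _ ≤ q * (Real.exp ((1 - q) * y) * Real.exp (q * y)) := by gcongr; exact h
      _ = q * Real.exp y := by rw [← Real.exp_add]; ring_nf

/-- For every integer `m ≥ 2` and every `0 < q < 1`,
`exp^{m-1}((log^{m-2} t)^q) ≤ log^{m-2}((exp^{m-1} t)^q)` for all sufficiently large `t`. -/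
theorem iterated_exp_log_rpow_le (m : ℕ) (hm : 2 ≤ m) (q : ℝ) (hq0 : 0 < q) (hq1 : q < 1) :
    ∃ t₀ : ℝ, ∀ t ≥ t₀,
      Real.exp^[m - 1] ((Real.log^[m - 2] t) ^ q) ≤ Real.log^[m - 2] ((Real.exp^[m - 1] t) ^ q) := by
  obtain ⟨n, rfl⟩ := Nat.exists_eq_add_of_le' hm
  rw [← eventually_atTop]
  simp only [Nat.add_sub_cancel, show n + 2 - 1 = n + 1 by omega]
  filter_upwards [eventually_iterate_exp_iterate_log n,
    (tendsto_iterate_log_atTop n).eventually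
      (eventually_iterate_exp_rpow_le hq0 hq1 (n + n))] with t ht h
  apply le_iterate_log_of_iterate_exp_le
  rw [Function.iterate_add_apply _ n n (Real.log^[n] t), ht] at h
  rw [← Function.iterate_add_apply, ← add_assoc, Function.iterate_succ_apply',
    Function.iterate_succ_apply', ← Real.exp_mul, mul_comm]
  exact Real.exp_le_exp.2 h
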